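/- arXiv:2306.06626 — 2 statements merged into one kernel-verified Lean document; each statement's English description precedes it below -/
import Mathlib

section
/- For any normalized finite dataset and every s > 0, the data separation function satisfies the lower bound λ(s) ≥ 1 − (1/(d n)) ∑_{i=1}^n ∑_{l=1, l≠i}^n ‖x_i‖ · ‖x_l − x_i‖ · E_{z∼N(0,I_d)} ρ_s(x_l | x_i + s^{−1} z). -/
open MeasureTheory ProbabilityTheory Real

/-- Standard Gaussian measure `N(0, I_d)` on `ℝ^d`. -/
noncomputable def stdGaussian (d : ℕ) : Measure (EuclideanSpace ℝ (Fin d)) :=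
  (Measure.pi fun _ : Fin d => gaussianReal 0 1).map (EuclideanSpace.equiv (Fin d) ℝ).symm

/-- Softmax posterior weights `ρ_s(x_i | y)`. -/
noncomputable def rho (d n : ℕ) (s : ℝ) (x : Fin n → EuclideanSpace ℝ (Fin d))
    (i : Fin n) (y : EuclideanSpace ℝ (Fin d)) : ℝ :=
  Real.exp (-(s ^ 2 / 2) * ‖x i - y‖ ^ 2) / ∑ l, Real.exp (-(s ^ 2 / 2) * ‖x l - y‖ ^ 2)

/-- The data separation function `λ(s)`. -/
noncomputable def lamSep (d n : ℕ) (x : Fin n → EuclideanSpace ℝ (Fin d)) (s : ℝ) : ℝ :=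
  (1 / ((d : ℝ) * n)) *
    ∑ j, ∫ z, ‖∑ i, rho d n s x i (x j + s⁻¹ • z) • x i‖ ^ 2 ∂ stdGaussian d

lemma pi_gauss_eq (d : ℕ) :
    (Measure.pi fun _ : Fin d => gaussianReal 0 1) =
      (volume : Measure (Fin d → ℝ)).withDensity
        (fun z => ENNReal.ofReal (∏ i, gaussianPDFReal 0 1 (z i))) := by
  refine Measure.pi_eq fun t ht => ?_
  rw [withDensity_apply _ (MeasurableSet.univ_pi ht), volume_pi, Measure.restrict_pi_pi,
    ← ofReal_integral_eq_lintegral_ofReal]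
  · rw [integral_fintype_prod_eq_prod (f := fun _ : Fin d => gaussianPDFReal 0 1),
      ENNReal.ofReal_prod_of_nonneg]
    · exact Finset.prod_congr rfl fun i _ =>
        (gaussianReal_apply_eq_integral 0 one_ne_zero (t i)).symm
    · intro i _
      exact integral_nonneg fun y => gaussianPDFReal_nonneg _ _ _
  · exact Integrable.fintype_prod (f := fun _ : Fin d => gaussianPDFReal 0 1)
      fun i => (integrable_gaussianPDFReal 0 1).restrict
  · exact ae_of_all _ fun z => Finset.prod_nonneg fun i _ => gaussianPDFReal_nonneg _ _ _

instance stdG_prob (d : ℕ) : IsProbabilityMeasure (_root_.stdGaussian d) := by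
  unfold _root_.stdGaussian
  exact Measure.isProbabilityMeasure_map
    (EuclideanSpace.equiv (Fin d) ℝ).symm.continuous.measurable.aemeasurable

lemma integral_stdG (d : ℕ) (f : EuclideanSpace ℝ (Fin d) → ℝ) :
    ∫ z, f z ∂(_root_.stdGaussian d) =
      ((√(2 * π))⁻¹) ^ d * ∫ z, rexp (-(1 / 2) * ‖z‖ ^ 2) * f z := by
  have hm : Measurable fun z : Fin d → ℝ => ∏ i, gaussianPDFReal 0 1 (z i) :=
    Finset.measurable_prod _ fun i _ =>
      (measurable_gaussianPDFReal 0 1).comp (measurable_pi_apply i)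
  have e1 : _root_.stdGaussian d = (Measure.pi fun _ : Fin d => gaussianReal 0 1).map
      (MeasurableEquiv.toLp 2 (Fin d → ℝ)) := rfl
  rw [e1, integral_map_equiv, pi_gauss_eq,
    integral_withDensity_eq_integral_toReal_smul hm.ennreal_ofReal
      (ae_of_all _ fun _ => ENNReal.ofReal_lt_top), ← integral_const_mul,
    ← (PiLp.volume_preserving_toLp (Fin d)).integral_comp
      (MeasurableEquiv.toLp 2 (Fin d → ℝ)).measurableEmbedding]
  refine integral_congr_ae (ae_of_all _ fun z => ?_)
  have h0 : 0 ≤ ∏ i, gaussianPDFReal 0 1 (z i) :=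
    Finset.prod_nonneg fun i _ => gaussianPDFReal_nonneg _ _ _
  have h1 : ∏ i, gaussianPDFReal 0 1 (z i) =
      ((√(2 * π))⁻¹) ^ d * rexp (-(1 / 2) * ‖(WithLp.toLp 2 z : EuclideanSpace ℝ (Fin d))‖ ^ 2) := by
    rw [EuclideanSpace.norm_sq_eq, Finset.mul_sum, Real.exp_sum]
    simp only [gaussianPDFReal, Finset.prod_mul_distrib, Finset.prod_const, Finset.card_univ,
      Fintype.card_fin, NNReal.coe_one, mul_one]
    congr 1
    refine Finset.prod_congr rfl fun i _ => ?_
    congr 1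
    simp only [Real.norm_eq_abs, sq_abs]
    ring
  simp only [ENNReal.toReal_ofReal h0, smul_eq_mul]
  rw [h1, mul_assoc]
  rfl

lemma integral_stdG_shift (d : ℕ) (s : ℝ) (hs : 0 < s) (a : EuclideanSpace ℝ (Fin d))
    (f : EuclideanSpace ℝ (Fin d) → ℝ) :
    ∫ z, f (a + s⁻¹ • z) ∂(_root_.stdGaussian d) =
      (((√(2 * π))⁻¹) ^ d * s ^ d) * ∫ y, f y * rexp (-(s ^ 2 / 2) * ‖a - y‖ ^ 2) := by
  rw [integral_stdG, mul_assoc]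
  congr 1
  have h1 : ∀ z : EuclideanSpace ℝ (Fin d), rexp (-(1 / 2) * ‖z‖ ^ 2) * f (a + s⁻¹ • z) =
      (fun u => rexp (-(s ^ 2 / 2) * ‖u‖ ^ 2) * f (a + u)) (s⁻¹ • z) := by
    intro z
    simp only [norm_smul, Real.norm_eq_abs, abs_of_pos (inv_pos.2 hs)]
    congr 2
    field_simp
  rw [integral_congr_ae (ae_of_all _ h1), Measure.integral_comp_inv_smul_of_nonneg volume
    (fun u : EuclideanSpace ℝ (Fin d) => rexp (-(s ^ 2 / 2) * ‖u‖ ^ 2) * f (a + u)) hs.le, finrank_euclideanSpace_fin, smul_eq_mul]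
  congr 1
  rw [← integral_add_left_eq_self (fun y => f y * rexp (-(s ^ 2 / 2) * ‖a - y‖ ^ 2)) a]
  refine integral_congr_ae (ae_of_all _ fun z => ?_)
  simp [mul_comm]

lemma integrable_w (d : ℕ) (s : ℝ) (hs : 0 < s) (a : EuclideanSpace ℝ (Fin d)) :
    Integrable fun y : EuclideanSpace ℝ (Fin d) => rexp (-(s ^ 2 / 2) * ‖a - y‖ ^ 2) := by
  have hb : 0 < ((s ^ 2 / 2 : ℝ) : ℂ).re := by
    rw [Complex.ofReal_re]; positivity
  have h := (GaussianFourier.integrable_cexp_neg_mul_sq_norm_add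
    (V := EuclideanSpace ℝ (Fin d)) hb 0 0).norm
  have h2 : Integrable fun y : EuclideanSpace ℝ (Fin d) => rexp (-(s ^ 2 / 2) * ‖y‖ ^ 2) := by
    refine h.congr (ae_of_all _ fun y => ?_)
    simp only [zero_mul, add_zero, Complex.norm_exp]
    congr 1
    rw [← Complex.ofReal_neg, ← Complex.ofReal_pow, ← Complex.ofReal_mul, Complex.ofReal_re]
  exact h2.comp_sub_left a

lemma denom_pos {d n : ℕ} (hn : 1 ≤ n) (s : ℝ) (x : Fin n → EuclideanSpace ℝ (Fin d))
    (y : EuclideanSpace ℝ (Fin d)) : 0 < ∑ l, rexp (-(s ^ 2 / 2) * ‖x l - y‖ ^ 2) :=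
  Finset.sum_pos (fun _ _ => Real.exp_pos _) ⟨⟨0, hn⟩, Finset.mem_univ _⟩

lemma rho_nonneg {d n : ℕ} (s : ℝ) (x : Fin n → EuclideanSpace ℝ (Fin d)) (i : Fin n)
    (y : EuclideanSpace ℝ (Fin d)) : 0 ≤ rho d n s x i y := by
  unfold rho; positivity

lemma rho_sum {d n : ℕ} (hn : 1 ≤ n) (s : ℝ) (x : Fin n → EuclideanSpace ℝ (Fin d))
    (y : EuclideanSpace ℝ (Fin d)) : ∑ i, rho d n s x i y = 1 := by
  unfold rho
  rw [← Finset.sum_div, div_self (denom_pos hn s x y).ne']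

lemma rho_le_one {d n : ℕ} (hn : 1 ≤ n) (s : ℝ) (x : Fin n → EuclideanSpace ℝ (Fin d))
    (i : Fin n) (y : EuclideanSpace ℝ (Fin d)) : rho d n s x i y ≤ 1 := by
  rw [← rho_sum hn s x y]
  exact Finset.single_le_sum (f := fun i => rho d n s x i y)
    (fun i _ => rho_nonneg s x i y) (Finset.mem_univ i)

lemma rho_cont {d n : ℕ} (hn : 1 ≤ n) (s : ℝ) (x : Fin n → EuclideanSpace ℝ (Fin d))
    (i : Fin n) : Continuous (rho d n s x i) := by
  unfold rho
  exact Continuous.div (by fun_prop) (by fun_prop) fun y => (denom_pos hn s x y).ne'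

/-- Posterior mean. -/
noncomputable def pmean (d n : ℕ) (s : ℝ) (x : Fin n → EuclideanSpace ℝ (Fin d))
    (y : EuclideanSpace ℝ (Fin d)) : EuclideanSpace ℝ (Fin d) :=
  ∑ i, rho d n s x i y • x i

lemma pmean_cont {d n : ℕ} (hn : 1 ≤ n) (s : ℝ) (x : Fin n → EuclideanSpace ℝ (Fin d)) :
    Continuous (pmean d n s x) := by
  unfold pmean
  exact continuous_finsetSum _ fun i _ => (rho_cont hn s x i).smul continuous_const

lemma pmean_bdd {d n : ℕ} (hn : 1 ≤ n) (s : ℝ) (x : Fin n → EuclideanSpace ℝ (Fin d))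
    (y : EuclideanSpace ℝ (Fin d)) : ‖pmean d n s x y‖ ≤ ∑ i, ‖x i‖ := by
  refine (norm_sum_le _ _).trans (Finset.sum_le_sum fun i _ => ?_)
  rw [norm_smul, Real.norm_of_nonneg (rho_nonneg s x i y)]
  exact mul_le_of_le_one_left (norm_nonneg _) (rho_le_one hn s x i y)

lemma tower {d n : ℕ} (hn : 1 ≤ n) (s : ℝ) (hs : 0 < s)
    (x : Fin n → EuclideanSpace ℝ (Fin d)) :
    ∑ j, ∫ z, ‖pmean d n s x (x j + s⁻¹ • z)‖ ^ 2 ∂(_root_.stdGaussian d) =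
      ∑ j, ∫ z, inner ℝ (x j) (pmean d n s x (x j + s⁻¹ • z)) ∂(_root_.stdGaussian d) := by
  have hc := pmean_cont hn s x
  have e1 : ∀ j, ∫ z, ‖pmean d n s x (x j + s⁻¹ • z)‖ ^ 2 ∂(_root_.stdGaussian d) = _ :=
    fun j => integral_stdG_shift d s hs (x j) (fun y => ‖pmean d n s x y‖ ^ 2)
  have e2 : ∀ j, ∫ z, inner ℝ (x j) (pmean d n s x (x j + s⁻¹ • z)) ∂(_root_.stdGaussian d) = _ :=
    fun j => integral_stdG_shift d s hs (x j) (fun y => inner ℝ (x j) (pmean d n s x y))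
  simp_rw [e1, e2]
  rw [← Finset.mul_sum, ← Finset.mul_sum, ← integral_finsetSum, ← integral_finsetSum]
  · congr 1
    refine integral_congr_ae (ae_of_all _ fun y => ?_)
    have hW := denom_pos hn s x y
    have h1 : (∑ l, rexp (-(s ^ 2 / 2) * ‖x l - y‖ ^ 2)) • pmean d n s x y =
        ∑ j, rexp (-(s ^ 2 / 2) * ‖x j - y‖ ^ 2) • x j := by
      unfold pmean rho
      rw [Finset.smul_sum]
      refine Finset.sum_congr rfl fun i _ => ?_
      rw [smul_smul, mul_div_cancel₀ _ hW.ne']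
    have h2 := congrArg (fun v => inner ℝ v (pmean d n s x y)) h1
    simp only [sum_inner, real_inner_smul_left, real_inner_self_eq_norm_sq] at h2
    simp only
    rw [← Finset.mul_sum, mul_comm, h2]
    exact Finset.sum_congr rfl fun i _ => mul_comm _ _
  · intro j _
    refine (integrable_w d s hs (x j)).bdd_mul (c := ‖x j‖ * ∑ i, ‖x i‖)
      (Continuous.aestronglyMeasurable (by fun_prop)) (ae_of_all _ fun y => ?_)
    exact (norm_inner_le_norm _ _).trans (by gcongr; exact pmean_bdd hn s x y)
  · intro j _
    refine (integrable_w d s hs (x j)).bdd_mul (c := (∑ i, ‖x i‖) ^ 2)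
      (Continuous.aestronglyMeasurable (by fun_prop)) (ae_of_all _ fun y => ?_)
    rw [norm_pow, norm_norm]
    gcongr
    exact pmean_bdd hn s x y

lemma pointwise {d n : ℕ} (hn : 1 ≤ n) (s : ℝ)
    (x : Fin n → EuclideanSpace ℝ (Fin d)) (j : Fin n) (y : EuclideanSpace ℝ (Fin d)) :
    ‖x j‖ ^ 2 - ∑ l ∈ Finset.univ.erase j, ‖x j‖ * ‖x l - x j‖ * rho d n s x l y ≤
      inner ℝ (x j) (pmean d n s x y) := by
  have h1 : pmean d n s x y = x j + ∑ l ∈ Finset.univ.erase j, rho d n s x l y • (x l - x j) := by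
    rw [Finset.sum_erase _ (by simp)]
    simp only [smul_sub, Finset.sum_sub_distrib, ← Finset.sum_smul, rho_sum hn s x y, one_smul]
    simp [pmean]
  rw [h1, inner_add_right, inner_sum, real_inner_self_eq_norm_sq, sub_eq_add_neg,
    ← Finset.sum_neg_distrib]
  gcongr with l _
  rw [real_inner_smul_right]
  have h2 := neg_le_of_abs_le (abs_real_inner_le_norm (x j) (x l - x j))
  nlinarith [rho_nonneg s x l y]

/-- For any normalized finite dataset and every `s > 0`,
`λ(s) ≥ 1 − (1/(dn)) ∑_i ∑_{l ≠ i} ‖x_i‖ ‖x_l − x_i‖ E_{z∼N(0,I)} ρ_s(x_l | x_i + s⁻¹ z)`. -/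
theorem one_sub_le_lamSep (d n : ℕ) (hd : 1 ≤ d) (hn : 1 ≤ n)
    (x : Fin n → EuclideanSpace ℝ (Fin d))
    (hmean : (n : ℝ)⁻¹ • ∑ i, x i = 0)
    (hvar : 1 / ((d : ℝ) * n) * ∑ i, ‖x i‖ ^ 2 = 1)
    (s : ℝ) (hs : 0 < s) :
    1 - (1 / ((d : ℝ) * n)) *
        ∑ i, ∑ l ∈ Finset.univ.erase i,
          ‖x i‖ * ‖x l - x i‖ * ∫ z, rho d n s x l (x i + s⁻¹ • z) ∂ stdGaussian d
      ≤ lamSep d n x s := by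
  have hmain : ∀ j, ‖x j‖ ^ 2 - ∑ l ∈ Finset.univ.erase j,
      ‖x j‖ * ‖x l - x j‖ * ∫ z, rho d n s x l (x j + s⁻¹ • z) ∂(_root_.stdGaussian d) ≤
      ∫ z, inner ℝ (x j) (pmean d n s x (x j + s⁻¹ • z)) ∂(_root_.stdGaussian d) := by
    intro j
    have hr : ∀ l, Integrable (fun z => rho d n s x l (x j + s⁻¹ • z)) (_root_.stdGaussian d) := by
      intro l
      have := rho_cont hn s x l
      refine Integrable.of_bound (Continuous.aestronglyMeasurable (by fun_prop)) 1
        (ae_of_all _ fun z => ?_)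
      rw [Real.norm_of_nonneg (rho_nonneg _ _ _ _)]
      exact rho_le_one hn s x l _
    have hsum : Integrable (fun z => ∑ l ∈ Finset.univ.erase j,
        ‖x j‖ * ‖x l - x j‖ * rho d n s x l (x j + s⁻¹ • z)) (_root_.stdGaussian d) :=
      integrable_finsetSum _ fun l _ => (hr l).const_mul _
    have hi : Integrable (fun z => inner ℝ (x j) (pmean d n s x (x j + s⁻¹ • z)))
        (_root_.stdGaussian d) := by
      have := pmean_cont hn s x
      refine Integrable.of_bound (Continuous.aestronglyMeasurable (by fun_prop))
        (‖x j‖ * ∑ i, ‖x i‖) (ae_of_all _ fun z => ?_)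
      exact (norm_inner_le_norm _ _).trans (by gcongr; exact pmean_bdd hn s x _)
    have h := integral_mono ((integrable_const (‖x j‖ ^ 2)).sub hsum) hi
      fun z => pointwise hn s x j (x j + s⁻¹ • z)
    simp only [Pi.sub_apply] at h
    rw [integral_sub (integrable_const _) hsum,
      integral_finsetSum _ fun l _ => (hr l).const_mul _] at h
    simpa [integral_const_mul] using h
  have ht := tower hn s hs x
  have h := Finset.sum_le_sum fun j (_ : j ∈ Finset.univ) => hmain j
  rw [← ht, Finset.sum_sub_distrib] at h
  have hk : 0 ≤ 1 / ((d : ℝ) * n) := by positivity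
  have h2 := mul_le_mul_of_nonneg_left h hk
  rw [mul_sub, hvar] at h2
  exact h2
end

section
/- Let (a_t, m_t) be a scheduler pair such that a_t/m_t is strictly monotonically increasing on (0,1) and ‖a‖_{1,∞} ≤ M, ‖m‖_{1,∞} ≤ M for some M > 0. Then for any normalized finite dataset, the change of variables s = a_t/m_t yields ∫₀¹ β_t² (1 − λ(a_t/m_t)) dt ≤ 2 M² ∫₀^∞ (1 − λ(s)) ds. -/
open MeasureTheory ProbabilityTheory Real

lemma kg_eq (d : ℕ) : _root_.stdGaussian d = ProbabilityTheory.stdGaussian (EuclideanSpace ℝ (Fin d)) := by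
  rw [← ProbabilityTheory.map_pi_eq_stdGaussian]; rfl

instance kg_prob (d : ℕ) : IsProbabilityMeasure (_root_.stdGaussian d) := by
  rw [kg_eq]; infer_instance

/-- The Gaussian normalising constant. -/
noncomputable def kgC (d : ℕ) : ℝ := (π / (1 / 2)) ^ ((d : ℝ) / 2)

lemma kgC_pos (d : ℕ) : 0 < kgC d := by unfold kgC; positivity

lemma kg_integrable_exp (d : ℕ) :
    Integrable (fun z : EuclideanSpace ℝ (Fin d) => Real.exp (-(1 / 2) * ‖z‖ ^ 2)) := by
  apply Integrable.of_integral_ne_zero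
  rw [GaussianFourier.integral_rexp_neg_mul_sq_norm (by norm_num)]
  positivity

lemma kg_density (d : ℕ) : _root_.stdGaussian d = (volume : Measure (EuclideanSpace ℝ (Fin d))).withDensity
    (fun z => ((((kgC d)⁻¹ * Real.exp (-(1 / 2) * ‖z‖ ^ 2)).toNNReal : NNReal) : ENNReal)) := by
  have hfin : IsFiniteMeasure ((volume : Measure (EuclideanSpace ℝ (Fin d))).withDensity
    (fun z => ((((kgC d)⁻¹ * Real.exp (-(1 / 2) * ‖z‖ ^ 2)).toNNReal : NNReal) : ENNReal))) := by
    apply isFiniteMeasure_withDensity_ofReal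
    exact ((kg_integrable_exp d).const_mul _).2
  apply Measure.ext_of_charFun
  ext t
  rw [kg_eq, charFun_stdGaussian, charFun_apply, integral_withDensity_eq_integral_smul (by fun_prop)]
  have h := GaussianFourier.integral_cexp_neg_mul_sq_norm_add (b := (1 / 2 : ℂ)) (by norm_num)
    Complex.I t
  have h2 : ∀ v : EuclideanSpace ℝ (Fin d),
      ((kgC d)⁻¹ * Real.exp (-(1 / 2) * ‖v‖ ^ 2)).toNNReal • Complex.exp ((inner ℝ v t : ℝ) * Complex.I)
      = ((kgC d)⁻¹ : ℂ) * Complex.exp (-(1 / 2) * ‖v‖ ^ 2 + Complex.I * (inner ℝ t v : ℝ)) := by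
    intro v
    have := kgC_pos d
    rw [NNReal.smul_def, Real.coe_toNNReal _ (by positivity), Complex.exp_add, real_inner_comm,
      mul_comm Complex.I]
    simp
    ring
  simp_rw [h2]
  rw [integral_const_mul, h]
  have h3 : ((π : ℂ) / (1 / 2)) ^ (((Module.finrank ℝ (EuclideanSpace ℝ (Fin d)) : ℕ) : ℂ) / 2) = (kgC d : ℂ) := by
    unfold kgC
    rw [Complex.ofReal_cpow (by positivity)]
    simp
  rw [h3, ← mul_assoc, inv_mul_cancel₀ (by exact_mod_cast (kgC_pos d).ne'), one_mul]
  congr 1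
  simp
  ring

lemma kg_integral (d : ℕ) (f : EuclideanSpace ℝ (Fin d) → ℝ) :
    ∫ z, f z ∂ _root_.stdGaussian d = (kgC d)⁻¹ * ∫ z, Real.exp (-(1 / 2) * ‖z‖ ^ 2) * f z := by
  rw [kg_density, integral_withDensity_eq_integral_smul (by fun_prop), ← integral_const_mul]
  congr 1
  ext z
  have := kgC_pos d
  rw [NNReal.smul_def, Real.coe_toNNReal _ (by positivity), smul_eq_mul]
  ring

lemma kg_shift (d : ℕ) (s : ℝ) (hs : 0 < s) : ∃ K : ℝ, 0 < K ∧
    ∀ (f : EuclideanSpace ℝ (Fin d) → ℝ) (u : EuclideanSpace ℝ (Fin d)),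
    ∫ z, f (u + s⁻¹ • z) ∂ _root_.stdGaussian d
      = K * ∫ y, Real.exp (-(s ^ 2 / 2) * ‖u - y‖ ^ 2) * f y := by
  refine ⟨(kgC d)⁻¹ * |((s⁻¹) ^ Module.finrank ℝ (EuclideanSpace ℝ (Fin d)))⁻¹|, ?_, ?_⟩
  · have := kgC_pos d
    positivity
  · intro f u
    rw [kg_integral, mul_assoc]
    congr 1
    rw [← integral_add_left_eq_self (μ := volume)
      (fun y => Real.exp (-(s ^ 2 / 2) * ‖u - y‖ ^ 2) * f y) u, ← smul_eq_mul, 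
      ← Measure.integral_comp_smul]
    congr 1
    ext z
    have : ‖u - (u + s⁻¹ • z)‖ ^ 2 = (s⁻¹) ^ 2 * ‖z‖ ^ 2 := by
      rw [sub_add_cancel_left, norm_neg, norm_smul, mul_pow]; simp
    rw [this]
    congr 2
    field_simp

lemma kg_mgf (d : ℕ) (v : EuclideanSpace ℝ (Fin d)) :
    Integrable (fun z => Real.exp (inner ℝ v z)) (_root_.stdGaussian d) ∧
    ∫ z, Real.exp (inner ℝ v z) ∂ _root_.stdGaussian d = Real.exp (‖v‖ ^ 2 / 2) := by
  have h : ∫ z, Real.exp (inner ℝ v z) ∂ _root_.stdGaussian d = Real.exp (‖v‖ ^ 2 / 2) := by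
    rw [kg_eq]
    have h1 := IsGaussian.map_eq_gaussianReal
      (μ := ProbabilityTheory.stdGaussian (EuclideanSpace ℝ (Fin d))) (innerSL ℝ v)
    have h2 := mgf_gaussianReal h1 1
    rw [variance_dual_stdGaussian, integral_strongDual_stdGaussian, innerSL_apply_norm] at h2
    simp only [mgf, innerSL_apply_apply, one_mul] at h2
    rw [h2, Real.coe_toNNReal _ (by positivity)]
    simp
  refine ⟨Integrable.of_integral_ne_zero ?_, h⟩
  rw [h]; positivity

section
variable {d n : ℕ} {x : Fin n → EuclideanSpace ℝ (Fin d)}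

lemma kg_den_pos (hn : 1 ≤ n) (s : ℝ) (y : EuclideanSpace ℝ (Fin d)) :
    0 < ∑ l, Real.exp (-(s ^ 2 / 2) * ‖x l - y‖ ^ 2) := by
  have : Nonempty (Fin n) := ⟨⟨0, hn⟩⟩
  exact Finset.sum_pos (fun i _ => Real.exp_pos _) Finset.univ_nonempty

lemma kg_rho_nonneg (s : ℝ) (i : Fin n) (y : EuclideanSpace ℝ (Fin d)) : 0 ≤ rho d n s x i y := by
  unfold rho; positivity

lemma kg_rho_sum (hn : 1 ≤ n) (s : ℝ) (y : EuclideanSpace ℝ (Fin d)) :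
    ∑ i, rho d n s x i y = 1 := by
  unfold rho
  rw [← Finset.sum_div, div_self (kg_den_pos hn s y).ne']

lemma kg_rho_meas (i : Fin n) (j : Fin n) :
    Measurable (fun p : ℝ × EuclideanSpace ℝ (Fin d) => rho d n p.1 x i (x j + p.1⁻¹ • p.2)) := by
  unfold rho
  fun_prop

lemma kg_rho_meas' (s : ℝ) (i : Fin n) : Measurable (rho d n s x i) := by
  unfold rho
  fun_prop

lemma kg_jensen (hn : 1 ≤ n) (s : ℝ) (y : EuclideanSpace ℝ (Fin d)) :
    ‖∑ i, rho d n s x i y • x i‖ ^ 2 ≤ ∑ i, rho d n s x i y * ‖x i‖ ^ 2 := by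
  have hc : ConvexOn ℝ Set.univ (fun v : EuclideanSpace ℝ (Fin d) => ‖v‖ ^ 2) :=
    convexOn_univ_norm.pow (fun _ _ => norm_nonneg _) 2
  exact hc.map_sum_le (fun i _ => kg_rho_nonneg s i y) (kg_rho_sum hn s y) (fun _ _ => trivial)

lemma kg_bound (s : ℝ) (hn : 1 ≤ n) (y : EuclideanSpace ℝ (Fin d)) :
    ‖∑ i, rho d n s x i y • x i‖ ^ 2 ≤ ∑ i, ‖x i‖ ^ 2 := by
  refine (kg_jensen hn s y).trans (Finset.sum_le_sum fun i _ => ?_)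
  have : rho d n s x i y ≤ 1 := by
    rw [← kg_rho_sum (x := x) hn s y]
    exact Finset.single_le_sum (f := fun i => rho d n s x i y)
      (fun i _ => kg_rho_nonneg s i y) (Finset.mem_univ i)
  nlinarith [sq_nonneg ‖x i‖]

lemma kg_pw (hn : 1 ≤ n) (s : ℝ) (y : EuclideanSpace ℝ (Fin d)) :
    ∑ j, Real.exp (-(s ^ 2 / 2) * ‖x j - y‖ ^ 2) * ‖∑ i, rho d n s x i y • x i‖ ^ 2
      ≤ ∑ j, Real.exp (-(s ^ 2 / 2) * ‖x j - y‖ ^ 2) * ‖x j‖ ^ 2 := by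
  have hp := kg_den_pos (x := x) hn s y
  rw [← Finset.sum_mul]
  refine (mul_le_mul_of_nonneg_left (kg_jensen hn s y) hp.le).trans (le_of_eq ?_)
  rw [Finset.mul_sum]
  refine Finset.sum_congr rfl fun i _ => ?_
  unfold rho
  rw [← mul_assoc, mul_div_cancel₀ _ hp.ne']

lemma kg_sum_le (hn : 1 ≤ n) (s : ℝ) (hs : 0 < s) :
    ∑ j, ∫ z, ‖∑ i, rho d n s x i (x j + s⁻¹ • z) • x i‖ ^ 2 ∂ _root_.stdGaussian d
      ≤ ∑ j, ‖x j‖ ^ 2 := by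
  obtain ⟨K, hK, h⟩ := kg_shift d s hs
  have h1 : ∀ j, K * ∫ y, Real.exp (-(s ^ 2 / 2) * ‖x j - y‖ ^ 2) = 1 := by
    intro j
    have := h (fun _ => 1) (x j)
    simpa using this.symm
  have hint : ∀ j, Integrable fun y => Real.exp (-(s ^ 2 / 2) * ‖x j - y‖ ^ 2) := by
    intro j
    apply Integrable.of_integral_ne_zero
    intro h0
    have := h1 j
    rw [h0] at this
    simp at this
  have h2 : ∀ j, ∫ z, ‖∑ i, rho d n s x i (x j + s⁻¹ • z) • x i‖ ^ 2 ∂ _root_.stdGaussian d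
      = K * ∫ y, Real.exp (-(s ^ 2 / 2) * ‖x j - y‖ ^ 2) * ‖∑ i, rho d n s x i y • x i‖ ^ 2 :=
    fun j => h (fun y => ‖∑ i, rho d n s x i y • x i‖ ^ 2) (x j)
  have hm : Measurable fun y => ‖∑ i, rho d n s x i y • x i‖ ^ 2 := by
    have := fun i => kg_rho_meas' (x := x) s i
    fun_prop
  simp_rw [h2]
  rw [← Finset.mul_sum, ← integral_finsetSum]
  · calc _ ≤ K * ∫ y, ∑ j, Real.exp (-(s ^ 2 / 2) * ‖x j - y‖ ^ 2) * ‖x j‖ ^ 2 := by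
          refine mul_le_mul_of_nonneg_left (integral_mono_of_nonneg ?_ ?_ ?_) hK.le
          · exact Filter.Eventually.of_forall fun y => by simp only [Pi.zero_apply]; positivity
          · exact integrable_finsetSum _ fun j _ => (hint j).mul_const _
          · exact Filter.Eventually.of_forall fun y => kg_pw hn s y
      _ = _ := by
          rw [integral_finsetSum _ fun j _ => (hint j).mul_const _, Finset.mul_sum]
          refine Finset.sum_congr rfl fun j _ => ?_
          rw [integral_mul_const, ← mul_assoc, h1, one_mul]
  · intro j _
    refine (hint j).mul_bdd (c := ∑ i, ‖x i‖ ^ 2) hm.aestronglyMeasurable ?_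
    refine Filter.Eventually.of_forall fun y => ?_
    rw [Real.norm_of_nonneg (by positivity)]
    exact kg_bound s hn y

lemma kg_lam_le (hn : 1 ≤ n) (hvar : 1 / ((d : ℝ) * n) * ∑ i, ‖x i‖ ^ 2 = 1) (s : ℝ) (hs : 0 < s) :
    0 ≤ 1 - lamSep d n x s := by
  rw [sub_nonneg, ← hvar]
  unfold lamSep
  exact mul_le_mul_of_nonneg_left (kg_sum_le hn s hs) (by positivity)

lemma kg_rho_le (s : ℝ) (hs : 0 < s) (i j : Fin n) (z : EuclideanSpace ℝ (Fin d)) :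
    rho d n s x i (x j + s⁻¹ • z) ≤
      Real.exp (-(s ^ 2 / 4) * ‖x i - x j‖ ^ 2) * Real.exp (inner ℝ ((s / 2) • (x i - x j)) z) := by
  set y := x j + s⁻¹ • z with hy
  set A := Real.exp (-(s ^ 2 / 4) * ‖x i - y‖ ^ 2) with hA
  set B := Real.exp (-(s ^ 2 / 4) * ‖x j - y‖ ^ 2) with hB
  have hA0 : 0 < A := Real.exp_pos _
  have hB0 : 0 < B := Real.exp_pos _
  have hA2 : Real.exp (-(s ^ 2 / 2) * ‖x i - y‖ ^ 2) = A ^ 2 := by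
    rw [hA, ← Real.exp_nat_mul]; congr 1; push_cast; ring
  have hB2 : Real.exp (-(s ^ 2 / 2) * ‖x j - y‖ ^ 2) = B ^ 2 := by
    rw [hB, ← Real.exp_nat_mul]; congr 1; push_cast; ring
  have hle : ∀ k, Real.exp (-(s ^ 2 / 2) * ‖x k - y‖ ^ 2) ≤
      ∑ l, Real.exp (-(s ^ 2 / 2) * ‖x l - y‖ ^ 2) := fun k =>
    Finset.single_le_sum (f := fun l => Real.exp (-(s ^ 2 / 2) * ‖x l - y‖ ^ 2))
      (fun i _ => (Real.exp_pos _).le) (Finset.mem_univ k)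
  have hi := hle i
  have hj := hle j
  have key : rho d n s x i y ≤ A / B := by
    unfold rho
    rw [hA2] at hi ⊢
    rw [hB2] at hj
    set D := ∑ l, Real.exp (-(s ^ 2 / 2) * ‖x l - y‖ ^ 2)
    have hD : 0 < D := lt_of_lt_of_le (by positivity) hi
    rw [div_le_div_iff₀ hD hB0]
    have : A * B ≤ D := by nlinarith [sq_nonneg (A - B)]
    nlinarith
  refine key.trans (le_of_eq ?_)
  rw [hA, hB, ← Real.exp_sub, ← Real.exp_add]
  congr 1
  have e1 : x j - y = -(s⁻¹ • z) := by rw [hy]; abel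
  have e2 : x i - y = (x i - x j) - s⁻¹ • z := by rw [hy]; abel
  rw [e1, e2, norm_neg, norm_sub_sq_real, real_inner_smul_left, real_inner_smul_right]
  field_simp
  ring

lemma kg_rho_int (s : ℝ) (hs : 0 < s) (i j : Fin n) :
    Integrable (fun z => rho d n s x i (x j + s⁻¹ • z)) (_root_.stdGaussian d) ∧
    ∫ z, rho d n s x i (x j + s⁻¹ • z) ∂ _root_.stdGaussian d
      ≤ Real.exp (-(‖x i - x j‖ ^ 2 / 8) * s ^ 2) := by
  obtain ⟨h1, h2⟩ := kg_mgf d ((s / 2) • (x i - x j))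
  have hb := h1.const_mul (Real.exp (-(s ^ 2 / 4) * ‖x i - x j‖ ^ 2))
  have hm : Measurable (fun z => rho d n s x i (x j + s⁻¹ • z)) :=
    (kg_rho_meas' s i).comp (by fun_prop)
  have hI : Integrable (fun z => rho d n s x i (x j + s⁻¹ • z)) (_root_.stdGaussian d) := by
    refine hb.mono' hm.aestronglyMeasurable (Filter.Eventually.of_forall fun z => ?_)
    rw [Real.norm_of_nonneg (kg_rho_nonneg _ _ _)]
    exact kg_rho_le s hs i j z
  refine ⟨hI, (integral_mono hI hb fun z => kg_rho_le s hs i j z).trans (le_of_eq ?_)⟩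
  rw [integral_const_mul, h2, ← Real.exp_add, norm_smul, mul_pow, Real.norm_eq_abs, sq_abs]
  congr 1
  ring

lemma kg_decay (hn : 1 ≤ n) (s : ℝ) (hs : 0 < s) (R : ℝ) (hR : ∀ i, ‖x i‖ ≤ R) (j : Fin n) :
    ‖x j‖ ^ 2 - ∫ z, ‖∑ i, rho d n s x i (x j + s⁻¹ • z) • x i‖ ^ 2 ∂ _root_.stdGaussian d
      ≤ 2 * R * ∑ i, ‖x i - x j‖ * Real.exp (-(‖x i - x j‖ ^ 2 / 8) * s ^ 2) := by
  have hR0 : 0 ≤ R := (norm_nonneg _).trans (hR j)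
  have hm : Measurable fun z => ‖∑ i, rho d n s x i (x j + s⁻¹ • z) • x i‖ ^ 2 := by
    have : ∀ i, Measurable (fun z => rho d n s x i (x j + s⁻¹ • z)) :=
      fun i => (kg_rho_meas' s i).comp (by fun_prop)
    fun_prop
  have hI : Integrable (fun z => ‖∑ i, rho d n s x i (x j + s⁻¹ • z) • x i‖ ^ 2)
      (_root_.stdGaussian d) := by
    refine (integrable_const (∑ i, ‖x i‖ ^ 2)).mono' hm.aestronglyMeasurable
      (Filter.Eventually.of_forall fun z => ?_)
    rw [Real.norm_of_nonneg (by positivity)]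
    exact kg_bound s hn _
  have hpt : ∀ z, ‖x j‖ ^ 2 - ‖∑ i, rho d n s x i (x j + s⁻¹ • z) • x i‖ ^ 2 ≤
      2 * R * ∑ i, ‖x i - x j‖ * rho d n s x i (x j + s⁻¹ • z) := by
    intro z
    set y := x j + s⁻¹ • z
    set e := ∑ i, rho d n s x i y • x i with he
    have h1 : ‖e - x j‖ ≤ ∑ i, ‖x i - x j‖ * rho d n s x i y := by
      have : e - x j = ∑ i, rho d n s x i y • (x i - x j) := by
        simp_rw [smul_sub]
        rw [Finset.sum_sub_distrib, ← Finset.sum_smul, kg_rho_sum hn, one_smul]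
      rw [this]
      refine (norm_sum_le _ _).trans (Finset.sum_le_sum fun i _ => ?_)
      rw [norm_smul, Real.norm_of_nonneg (kg_rho_nonneg _ _ _), mul_comm]
    have h2 : ‖e‖ ≤ R := by
      calc ‖e‖ ≤ ∑ i, ‖rho d n s x i y • x i‖ := norm_sum_le _ _
        _ ≤ ∑ i, rho d n s x i y * R := by
          refine Finset.sum_le_sum fun i _ => ?_
          rw [norm_smul, Real.norm_of_nonneg (kg_rho_nonneg _ _ _)]
          exact mul_le_mul_of_nonneg_left (hR i) (kg_rho_nonneg _ _ _)
        _ = R := by rw [← Finset.sum_mul, kg_rho_sum hn, one_mul]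
    have h3 : ‖x j‖ - ‖e‖ ≤ ‖e - x j‖ := by rw [norm_sub_rev]; exact norm_sub_norm_le _ _
    have h4 := hR j
    have h5 := norm_nonneg e
    have h6 := norm_nonneg (x j)
    calc ‖x j‖ ^ 2 - ‖e‖ ^ 2 = (‖x j‖ + ‖e‖) * (‖x j‖ - ‖e‖) := by ring
      _ ≤ (‖x j‖ + ‖e‖) * ‖e - x j‖ := mul_le_mul_of_nonneg_left h3 (by positivity)
      _ ≤ (2 * R) * ‖e - x j‖ := mul_le_mul_of_nonneg_right (by linarith) (norm_nonneg _)
      _ ≤ _ := mul_le_mul_of_nonneg_left h1 (by positivity)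
  have hsum : ∀ i ∈ Finset.univ, Integrable (fun z => ‖x i - x j‖ * rho d n s x i (x j + s⁻¹ • z))
      (_root_.stdGaussian d) := fun i _ => (kg_rho_int s hs i j).1.const_mul _
  have := integral_mono ((integrable_const (‖x j‖ ^ 2)).sub hI)
    ((integrable_finsetSum _ hsum).const_mul (2 * R)) hpt
  simp only [Pi.sub_apply] at this
  rw [integral_sub (integrable_const _) hI, integral_const_mul, integral_finsetSum _ hsum] at this
  simp only [integral_const, probReal_univ, one_smul] at this
  refine this.trans (mul_le_mul_of_nonneg_left (Finset.sum_le_sum fun i _ => ?_) (by positivity))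
  rw [integral_const_mul]
  exact mul_le_mul_of_nonneg_left (kg_rho_int s hs i j).2 (norm_nonneg _)

lemma kg_lam_meas : Measurable (lamSep d n x) := by
  unfold lamSep
  refine Measurable.const_mul (Finset.measurable_fun_sum _ fun j _ => ?_) _
  refine (StronglyMeasurable.integral_prod_right (f := fun s z =>
    ‖∑ i, rho d n s x i (x j + s⁻¹ • z) • x i‖ ^ 2) ?_).measurable
  refine Measurable.stronglyMeasurable ?_
  have := fun i => kg_rho_meas (x := x) i j
  unfold Function.uncurry
  fun_prop

lemma kg_lam_integrable (hn : 1 ≤ n)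
    (hvar : 1 / ((d : ℝ) * n) * ∑ i, ‖x i‖ ^ 2 = 1) :
    IntegrableOn (fun s => 1 - lamSep d n x s) (Set.Ioi 0) := by
  set R := ∑ i, ‖x i‖
  have hR : ∀ i, ‖x i‖ ≤ R := fun i =>
    Finset.single_le_sum (f := fun i => ‖x i‖) (fun i _ => norm_nonneg _) (Finset.mem_univ i)
  have hg : Integrable (fun s : ℝ => 1 / ((d : ℝ) * n) * ∑ j, 2 * R * ∑ i, ‖x i - x j‖ *
      Real.exp (-(‖x i - x j‖ ^ 2 / 8) * s ^ 2)) := by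
    refine Integrable.const_mul (integrable_finsetSum _ fun j _ => Integrable.const_mul
      (integrable_finsetSum _ fun i _ => ?_) _) _
    rcases eq_or_ne (‖x i - x j‖) 0 with h | h
    · simp [h]
    · exact (integrable_exp_neg_mul_sq (by positivity)).const_mul _
  refine Integrable.mono' hg.integrableOn (kg_lam_meas.const_sub 1).aestronglyMeasurable ?_
  refine (ae_restrict_iff' measurableSet_Ioi).2 (Filter.Eventually.of_forall fun s hs => ?_)
  rw [Real.norm_of_nonneg (kg_lam_le hn hvar s hs)]
  nth_rewrite 1 [← hvar]
  unfold lamSep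
  rw [← mul_sub, ← Finset.sum_sub_distrib]
  exact mul_le_mul_of_nonneg_left (Finset.sum_le_sum fun j _ => kg_decay hn s hs R hR j)
    (by positivity)

end

/-- For a scheduler pair `(a_t, m_t)` with strictly increasing `a_t/m_t` and Sobolev norms
bounded by `M`, the change of variables `s = a_t/m_t` yields
`∫₀¹ β_t² (1 − λ(a_t/m_t)) dt ≤ 2 M² ∫₀^∞ (1 − λ(s)) ds`. -/
theorem ke_gap_le_change_of_variables (d n : ℕ) (hd : 1 ≤ d) (hn : 1 ≤ n)
    (x : Fin n → EuclideanSpace ℝ (Fin d))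
    (hmean : (n : ℝ)⁻¹ • ∑ i, x i = 0)
    (hvar : 1 / ((d : ℝ) * n) * ∑ i, ‖x i‖ ^ 2 = 1)
    (a m : ℝ → ℝ) (M : ℝ) (hM : 0 < M)
    (ha_nonneg : ∀ t ∈ Set.Icc (0 : ℝ) 1, 0 ≤ a t)
    (hm_nonneg : ∀ t ∈ Set.Icc (0 : ℝ) 1, 0 ≤ m t)
    (ha_cont : ContinuousOn a (Set.Icc 0 1))
    (hm_cont : ContinuousOn m (Set.Icc 0 1))
    (ha_smooth : ContDiffOn ℝ (⊤ : ℕ∞) a (Set.Ioo 0 1))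
    (hm_smooth : ContDiffOn ℝ (⊤ : ℕ∞) m (Set.Ioo 0 1))
    (ha0 : a 0 = 0) (ha1 : a 1 = 1) (hm0 : m 0 = 1) (hm1 : m 1 = 0)
    (hmono : StrictMonoOn (fun t => a t / m t) (Set.Ioo 0 1))
    (haM : ∀ t ∈ Set.Icc (0 : ℝ) 1, |a t| ≤ M)
    (haM' : ∀ t ∈ Set.Ioo (0 : ℝ) 1, |deriv a t| ≤ M)
    (hmM : ∀ t ∈ Set.Icc (0 : ℝ) 1, |m t| ≤ M)
    (hmM' : ∀ t ∈ Set.Ioo (0 : ℝ) 1, |deriv m t| ≤ M) :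
    ∫ t in (0 : ℝ)..1,
        (deriv a t - a t * deriv m t / m t) ^ 2 * (1 - lamSep d n x (a t / m t))
      ≤ 2 * M ^ 2 * ∫ s in Set.Ioi (0 : ℝ), (1 - lamSep d n x s) := by
  have hnn : ∀ t ∈ Set.Ioo (0 : ℝ) 1, 0 ≤ a t / m t := fun t ht =>
    div_nonneg (ha_nonneg t (Set.Ioo_subset_Icc_self ht)) (hm_nonneg t (Set.Ioo_subset_Icc_self ht))
  have hpos : ∀ t ∈ Set.Ioo (0 : ℝ) 1, 0 < a t / m t := by
    intro t ht
    have h2 : t / 2 ∈ Set.Ioo (0 : ℝ) 1 := ⟨by linarith [ht.1], by linarith [ht.1, ht.2]⟩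
    exact (hnn _ h2).trans_lt (hmono h2 ht (by linarith [ht.1]))
  have hmpos : ∀ t ∈ Set.Ioo (0 : ℝ) 1, 0 < m t := by
    intro t ht
    refine lt_of_le_of_ne (hm_nonneg t (Set.Ioo_subset_Icc_self ht)) fun h => ?_
    have := hpos t ht
    rw [← h, div_zero] at this
    exact lt_irrefl _ this
  set c' : ℝ → ℝ := fun t => (deriv a t * m t - a t * deriv m t) / m t ^ 2 with hc'
  have hderiv : ∀ t ∈ Set.Ioo (0 : ℝ) 1, HasDerivAt (fun t => a t / m t) (c' t) t := by
    intro t ht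
    have hnb := isOpen_Ioo.mem_nhds ht
    have da := ((ha_smooth.differentiableOn (by simp)).differentiableAt hnb).hasDerivAt
    have dm := ((hm_smooth.differentiableOn (by simp)).differentiableAt hnb).hasDerivAt
    exact da.div dm (hmpos t ht).ne'
  have himg : (fun t => a t / m t) '' Set.Ioo 0 1 ⊆ Set.Ioi 0 := by
    rintro _ ⟨t, ht, rfl⟩
    exact hpos t ht
  have hint := kg_lam_integrable (x := x) hn hvar
  have hnonneg := fun s hs => kg_lam_le (x := x) hn hvar s hs
  have hI := (integrableOn_image_iff_integrableOn_abs_deriv_smul measurableSet_Ioo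
    (fun t ht => (hderiv t ht).hasDerivWithinAt) hmono.injOn
    (fun s => 1 - lamSep d n x s)).1 (hint.mono_set himg)
  have hE := integral_image_eq_integral_abs_deriv_smul measurableSet_Ioo
    (fun t ht => (hderiv t ht).hasDerivWithinAt) hmono.injOn (fun s => 1 - lamSep d n x s)
  have hle : ∫ s in (fun t => a t / m t) '' Set.Ioo 0 1, (1 - lamSep d n x s)
      ≤ ∫ s in Set.Ioi (0 : ℝ), (1 - lamSep d n x s) := by
    refine setIntegral_mono_set hint ?_ himg.eventuallyLE
    exact (ae_restrict_iff' measurableSet_Ioi).2 (Filter.Eventually.of_forall hnonneg)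
  refine le_trans ?_ (mul_le_mul_of_nonneg_left hle (by positivity))
  rw [hE, ← integral_const_mul, intervalIntegral.integral_of_le zero_le_one,
    integral_Ioc_eq_integral_Ioo]
  refine integral_mono_of_nonneg ?_ (hI.const_mul _) ?_
  · refine (ae_restrict_iff' measurableSet_Ioo).2 (Filter.Eventually.of_forall fun t ht => ?_)
    exact mul_nonneg (sq_nonneg _) (hnonneg _ (hpos t ht))
  · refine (ae_restrict_iff' measurableSet_Ioo).2 (Filter.Eventually.of_forall fun t ht => ?_)
    have hm := hmpos t ht
    simp only [smul_eq_mul]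
    rw [← mul_assoc]
    refine mul_le_mul_of_nonneg_right ?_ (hnonneg _ (hpos t ht))
    have htI := Set.Ioo_subset_Icc_self ht
    set q := deriv a t * m t - a t * deriv m t with hq
    have e1 : (deriv a t - a t * deriv m t / m t) ^ 2 = |q| * |c' t| := by
      rw [← abs_mul, hc']
      have : q * ((deriv a t * m t - a t * deriv m t) / m t ^ 2) = 
          (deriv a t - a t * deriv m t / m t) ^ 2 := by
        rw [hq]; field_simp
      simp only [this]
      rw [abs_of_nonneg (sq_nonneg _)]
    rw [e1]
    refine mul_le_mul_of_nonneg_right ?_ (abs_nonneg _)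
    have b1 : |deriv a t * m t| ≤ M * M := by
      rw [abs_mul]; exact mul_le_mul (haM' t ht) (hmM t htI) (abs_nonneg _) hM.le
    have b2 : |a t * deriv m t| ≤ M * M := by
      rw [abs_mul]; exact mul_le_mul (haM t htI) (hmM' t ht) (abs_nonneg _) hM.le
    have := abs_sub (deriv a t * m t) (a t * deriv m t)
    rw [hq]
    nlinarith
end
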